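/- arXiv:1411.4426 — 3 statements merged into one kernel-verified Lean document; each statement's English description precedes it below -/
import Mathlib

section
/- Let ε > 0, let a : ℕ → (0,∞) be a non-increasing sequence of positive reals with ∑_{i≥1} a(i) = ∞, and let b : ℕ → [0,∞) be a sequence of non-negative reals such that ∑_{i=1}^n b(i)/a(i) ≥ εn for all sufficiently large n. Then ∑_{i=1}^∞ b(i) = ∞. -/
open Filter

/-- Abel summation bound: if the partial sums of `c` are at least `-C` and `a` is antitone and
non-negative, then the partial sums of `a * c` are at least `-(C * a 0)`. -/
theorem neg_mul_le_sum_range_mul_of_antitone {a c : ℕ → ℝ} {C : ℝ}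
    (ha_nonneg : ∀ i, 0 ≤ a i) (ha_anti : Antitone a) (hC : 0 ≤ C)
    (hc : ∀ n, -C ≤ ∑ i ∈ Finset.range n, c i) (n : ℕ) :
    -(C * a 0) ≤ ∑ i ∈ Finset.range n, a i * c i := by
  have key : ∀ n, a n * ∑ i ∈ Finset.range (n + 1), c i - C * (a 0 - a n) ≤
      ∑ i ∈ Finset.range (n + 1), a i * c i := by
    intro n
    induction n with
    | zero => simp
    | succ n ih =>
      rw [Finset.sum_range_succ _ (n + 1), Finset.sum_range_succ _ (n + 1)]
      nlinarith [mul_nonneg (sub_nonneg.2 (ha_anti n.le_succ))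
        (sub_nonneg.2 (hc (n + 1)))]
  cases n with
  | zero => simpa using mul_nonneg hC (ha_nonneg 0)
  | succ n =>
    nlinarith [key n, mul_nonneg (ha_nonneg n) (sub_nonneg.2 (hc (n + 1)))]

/-- Lemma 3.3 of the paper.  Let `ε > 0`, let `a` be a non-increasing
sequence of positive reals with `∑ a(i) = ∞`, and let `b` be a sequence of non-negative
reals with `∑_{i=1}^n b(i)/a(i) ≥ ε n` for all sufficiently large `n`.
Then `∑ b(i) = ∞`. -/
theorem divergent_of_renormalized_linear
    (ε : ℝ) (hε : 0 < ε)
    (a : ℕ → ℝ) (ha_pos : ∀ i, 0 < a i) (ha_anti : Antitone a)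
    (ha_div : ¬ Summable a)
    (b : ℕ → ℝ) (hb_nonneg : ∀ i, 0 ≤ b i)
    (hgrow : ∀ᶠ n : ℕ in atTop, ε * n ≤ ∑ i ∈ Finset.range n, b i / a i) :
    ¬ Summable b := by
  intro hb
  obtain ⟨N, hN⟩ := eventually_atTop.1 hgrow
  have hpartial : ∀ n, -(ε * N) ≤ ∑ i ∈ Finset.range n, (b i / a i - ε) := by
    intro n
    rw [Finset.sum_sub_distrib, Finset.sum_const, Finset.card_range, nsmul_eq_mul]
    have hεN : 0 ≤ ε * N := by positivity
    rcases le_total N n with h | h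
    · linarith [hN n h]
    · have hsum : 0 ≤ ∑ i ∈ Finset.range n, b i / a i :=
        Finset.sum_nonneg fun i _ => div_nonneg (hb_nonneg i) (ha_pos i).le
      have hnN : ε * n ≤ ε * N := by gcongr
      linarith
  refine ha_div (summable_of_sum_range_le (c := (∑' i, b i + ε * N * a 0) / ε)
    (fun i => (ha_pos i).le) fun n => ?_)
  have habel := neg_mul_le_sum_range_mul_of_antitone (fun i => (ha_pos i).le) ha_anti
    (by positivity) hpartial n
  have hterm : ∀ i, a i * (b i / a i - ε) = b i - ε * a i := fun i => by
    rw [mul_sub, mul_div_cancel₀ _ (ha_pos i).ne', mul_comm ε]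
  simp only [hterm, Finset.sum_sub_distrib, ← Finset.mul_sum] at habel
  rw [le_div_iff₀ hε]
  linarith [hb.sum_le_tsum (Finset.range n) fun i _ => hb_nonneg i]
end

section
/- Let ℓ : ℕ → [0,∞) be any sequence of non-negative reals, and define 𝔇 := {n ∈ ℕ : ℓ(2^n) > ℓ(2^m)/2^{(n−m)/2} for all m < n}. Then ∑_{n ≥ 1} ℓ(2^n) is divergent if and only if ∑_{n ∈ 𝔇} ℓ(2^n) is divergent. -/
open scoped ENNReal

/-- If every `f n` with `n ∈ S` is dominated by a geometric decay `f d * r ^ (n - d)` from some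
earlier `d ∈ D`, then the sum of `f` over `S` is at most `(1 - r)⁻¹` times the sum over `D`. -/
theorem ENNReal.tsum_subtype_le_of_geometric_domination {p q : ℕ → Prop} (f : ℕ → ℝ≥0∞)
    (r : ℝ≥0∞)
    (h : ∀ n, p n → ∃ d, q d ∧ d ≤ n ∧ f n ≤ f d * r ^ (n - d)) :
    ∑' n : {n // p n}, f n ≤ (∑' d : {d // q d}, f d) * (1 - r)⁻¹ := by
  choose! d hq hle hf using h
  let e : {n // p n} → {d // q d} × ℕ := fun n => (⟨d n, hq n n.2⟩, n - d n)
  have he : Function.Injective e := by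
    intro m n hmn
    have h₁ : d m = d n := congrArg (fun x => (x.1 : ℕ)) hmn
    have h₂ : (m : ℕ) - d m = n - d n := congrArg Prod.snd hmn
    have hm := hle m m.2
    have hn := hle n n.2
    exact Subtype.ext (by omega)
  calc ∑' n : {n // p n}, f n
      ≤ ∑' n : {n // p n}, f (e n).1 * r ^ (e n).2 := ENNReal.tsum_le_tsum fun n => hf n n.2
    _ ≤ ∑' x : {d // q d} × ℕ, f x.1 * r ^ x.2 :=
        ENNReal.tsum_comp_le_tsum_of_injective he fun x => f x.1 * r ^ x.2
    _ = (∑' d : {d // q d}, f d) * (1 - r)⁻¹ := by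
        rw [ENNReal.tsum_prod (f := fun (d : {d // q d}) (k : ℕ) => f d * r ^ k)]
        simp_rw [ENNReal.tsum_mul_left, ENNReal.tsum_geometric, ENNReal.tsum_mul_right]

/-- Every index is dominated geometrically by an index satisfying the strict dominance
condition. -/
theorem exists_dominant_index_le (a : ℕ → ℝ) {b : ℝ} (hb : 0 < b) (n : ℕ) (hn : 1 ≤ n) :
    ∃ d, (1 ≤ d ∧ ∀ m, 1 ≤ m → m < d → a m * b ^ (d - m) < a d) ∧
      d ≤ n ∧ a n ≤ a d * b ^ (n - d) := by
  induction n using Nat.strong_induction_on with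
  | _ n ih =>
    by_cases hdom : ∀ m, 1 ≤ m → m < n → a m * b ^ (n - m) < a n
    · exact ⟨n, ⟨hn, hdom⟩, le_rfl, by simp⟩
    · push Not at hdom
      obtain ⟨m, hm, hmn, ham⟩ := hdom
      obtain ⟨d, hd, hdm, had⟩ := ih m hmn hm
      refine ⟨d, hd, hdm.trans hmn.le, ham.trans ?_⟩
      calc a m * b ^ (n - m) ≤ a d * b ^ (m - d) * b ^ (n - m) := by gcongr
        _ = a d * b ^ (n - d) := by
          rw [mul_assoc, ← pow_add]
          congr 2
          omega

theorem div_two_rpow_half_sub (x : ℝ) {m n : ℕ} (h : m ≤ n) :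
    x / (2 : ℝ) ^ (((n : ℝ) - (m : ℝ)) / 2) = x * ((2 : ℝ) ^ (-(1 / 2) : ℝ)) ^ (n - m) := by
  rw [← Real.rpow_mul_natCast zero_le_two, Nat.cast_sub h, div_eq_mul_inv,
    ← Real.rpow_neg zero_le_two]
  congr 2
  ring

/-- Lemma 5.3 of the paper.  For any sequence `ℓ` of non-negative reals
(indexed by the positive integers), with
`𝔇 := {n : ℓ(2^n) > ℓ(2^m)/2^{(n−m)/2} for all m < n}`, the sum `∑_{n ≥ 1} ℓ(2^n)` is
divergent if and only if `∑_{n ∈ 𝔇} ℓ(2^n)` is divergent (sums taken in `[0,∞]`). -/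
theorem divergent_iff_divergent_on_dominantIndices
    (ℓ : ℕ → ℝ) (hℓ_nonneg : ∀ i, 0 ≤ ℓ i) :
    (∑' n : {n : ℕ // 1 ≤ n}, ENNReal.ofReal (ℓ (2 ^ (n : ℕ))) = ⊤) ↔
      (∑' n : {n : ℕ // 1 ≤ n ∧ ∀ m : ℕ, 1 ≤ m → m < n →
          ℓ (2 ^ m) / (2 : ℝ) ^ (((n : ℝ) - (m : ℝ)) / 2) < ℓ (2 ^ (n : ℕ))},
        ENNReal.ofReal (ℓ (2 ^ (n : ℕ))) = ⊤) := by
  set b : ℝ := (2 : ℝ) ^ (-(1 / 2) : ℝ)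
  have hb0 : 0 < b := by positivity
  have hb1 : b < 1 := Real.rpow_lt_one_of_one_lt_of_neg one_lt_two (by norm_num)
  refine ⟨fun htop => ?_, fun htop => ?_⟩
  · have hle := ENNReal.tsum_subtype_le_of_geometric_domination
      (p := fun n => 1 ≤ n)
      (q := fun n => 1 ≤ n ∧ ∀ m : ℕ, 1 ≤ m → m < n →
        ℓ (2 ^ m) / (2 : ℝ) ^ (((n : ℝ) - (m : ℝ)) / 2) < ℓ (2 ^ n))
      (fun n => ENNReal.ofReal (ℓ (2 ^ n))) (ENNReal.ofReal b) fun n hn => by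
        obtain ⟨d, ⟨hd, hdom⟩, hdn, hle⟩ :=
          exists_dominant_index_le (fun k => ℓ (2 ^ k)) hb0 n hn
        refine ⟨d, ⟨hd, fun m hm hmd => ?_⟩, hdn, ?_⟩
        · rw [div_two_rpow_half_sub _ hmd.le]
          exact hdom m hm hmd
        · rw [← ENNReal.ofReal_pow hb0.le, ← ENNReal.ofReal_mul (hℓ_nonneg _)]
          exact ENNReal.ofReal_le_ofReal hle
    rw [htop, top_le_iff] at hle
    by_contra hne
    refine ENNReal.mul_ne_top hne (ENNReal.inv_ne_top.2 ?_) hle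
    exact (tsub_pos_of_lt (ENNReal.ofReal_lt_one.2 hb1)).ne'
  · rw [← top_le_iff, ← htop]
    exact ENNReal.tsum_comp_le_tsum_of_injective
      (Subtype.map_injective (fun _ h => h.1) Function.injective_id)
      fun n : {n : ℕ // 1 ≤ n} => ENNReal.ofReal (ℓ (2 ^ (n : ℕ)))
end

section
/- Suppose G is controlled near 0 and f : ℕ → ℕ is non-decreasing with ∑_{n≥0} G⁻¹(f(n)^{-1}) < ∞. Then there exists ε > 0 such that ∑_{n≥0} G⁻¹((1+ε)/f(n)) < ∞. -/
open Filter

noncomputable section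

/-- The cumulative distribution function `G(x) = ν([0,x])` of a Borel probability
measure `ν` on `[0,∞)` (i.e. with `ν((-∞,0)) = 0`). -/
def cdfOf (ν : MeasureTheory.Measure ℝ) (x : ℝ) : ℝ := (ν (Set.Iic x)).toReal

/-- The generalized inverse `G⁻¹(y) := inf {x ≥ 0 : G(x) ≥ y}`. -/
def cdfInv (ν : MeasureTheory.Measure ℝ) (y : ℝ) : ℝ :=
  sInf {x : ℝ | 0 ≤ x ∧ y ≤ cdfOf ν x}

/-- `G` is controlled near `0`: `G(x) > 0` for `x > 0` and, for some `c > 1`,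
`1 < liminf_{x→0+} G(cx)/G(x)` and `limsup_{x→0+} G(cx)/G(x) < ∞`. -/
def ControlledNearZero (ν : MeasureTheory.Measure ℝ) : Prop :=
  (∀ x : ℝ, 0 < x → 0 < cdfOf ν x) ∧
  ∃ c : ℝ, 1 < c ∧
    1 < Filter.liminf (fun x : ℝ => ENNReal.ofReal (cdfOf ν (c * x) / cdfOf ν x))
          (nhdsWithin 0 (Set.Ioi 0)) ∧
    Filter.limsup (fun x : ℝ => ENNReal.ofReal (cdfOf ν (c * x) / cdfOf ν x))
          (nhdsWithin 0 (Set.Ioi 0)) < ⊤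

/-- The cumulative distribution function is monotone. -/
lemma cdfOf_mono (ν : MeasureTheory.Measure ℝ) [MeasureTheory.IsProbabilityMeasure ν] :
    Monotone (cdfOf ν) := fun _ _ h =>
  ENNReal.toReal_mono (MeasureTheory.measure_ne_top _ _)
    (MeasureTheory.measure_mono (Set.Iic_subset_Iic.2 h))

lemma cdfOf_le_one (ν : MeasureTheory.Measure ℝ) [MeasureTheory.IsProbabilityMeasure ν] (x : ℝ) :
    cdfOf ν x ≤ 1 :=
  ENNReal.toReal_le_of_le_ofReal zero_le_one (by simpa using MeasureTheory.prob_le_one)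

lemma tendsto_cdfOf_atTop (ν : MeasureTheory.Measure ℝ) [MeasureTheory.IsProbabilityMeasure ν] :
    Tendsto (cdfOf ν) atTop (nhds 1) := by
  have h := MeasureTheory.tendsto_measure_Iic_atTop ν
  rw [MeasureTheory.measure_univ] at h
  exact (ENNReal.tendsto_toReal ENNReal.one_ne_top).comp h

lemma bddBelow_cdfInv_set (ν : MeasureTheory.Measure ℝ) (y : ℝ) :
    BddBelow {x : ℝ | 0 ≤ x ∧ y ≤ cdfOf ν x} := ⟨0, fun _ h => h.1⟩

lemma cdfInv_nonneg (ν : MeasureTheory.Measure ℝ) (y : ℝ) : 0 ≤ cdfInv ν y :=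
  Real.sInf_nonneg fun _ h => h.1

lemma cdfInv_le_of_le_cdfOf {ν : MeasureTheory.Measure ℝ} {x y : ℝ} (hx : 0 ≤ x)
    (h : y ≤ cdfOf ν x) : cdfInv ν y ≤ x :=
  csInf_le (bddBelow_cdfInv_set ν y) ⟨hx, h⟩

/-- Below level `1` the generalized inverse is a genuine infimum. -/
lemma le_cdfOf_of_cdfInv_lt {ν : MeasureTheory.Measure ℝ} [MeasureTheory.IsProbabilityMeasure ν]
    {x y : ℝ} (hy : y < 1) (h : cdfInv ν y < x) : y ≤ cdfOf ν x := by
  obtain ⟨z, hyz, hz⟩ :=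
    (((tendsto_cdfOf_atTop ν).eventually_const_lt hy).and (eventually_ge_atTop 0)).exists
  obtain ⟨w, hw, hwx⟩ :=
    exists_lt_of_csInf_lt (s := {x : ℝ | 0 ≤ x ∧ y ≤ cdfOf ν x}) ⟨z, hz, hyz.le⟩ h
  exact hw.2.trans (cdfOf_mono ν hwx.le)

/-- Above level `1` the generalized inverse takes the default value `sInf ∅ = 0`. -/
lemma cdfInv_of_one_lt {ν : MeasureTheory.Measure ℝ} [MeasureTheory.IsProbabilityMeasure ν]
    {y : ℝ} (hy : 1 < y) : cdfInv ν y = 0 := by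
  have : {x : ℝ | 0 ≤ x ∧ y ≤ cdfOf ν x} = ∅ :=
    Set.eq_empty_of_forall_notMem fun x hx => (hx.2.trans (cdfOf_le_one ν x)).not_gt hy
  rw [cdfInv, this, Real.sInf_empty]

/-- A controlled `G` grows by a fixed factor `r > 1` under dilation by some `c` near `0`. -/
lemma ControlledNearZero.exists_mul_le {ν : MeasureTheory.Measure ℝ} (h : ControlledNearZero ν) :
    ∃ c r δ : ℝ, 0 < c ∧ 1 < r ∧ 0 < δ ∧
      ∀ x, 0 < x → x < δ → r * cdfOf ν x ≤ cdfOf ν (c * x) := by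
  obtain ⟨hpos, c, hc, hlim, -⟩ := h
  obtain ⟨r, hr, hrl⟩ := exists_between hlim
  obtain ⟨δ, hδ, hδr⟩ := mem_nhdsGT_iff_exists_Ioo_subset.1 (eventually_lt_of_lt_liminf hrl)
  have hr_top : r ≠ ⊤ := hrl.ne_top
  refine ⟨c, r.toReal, δ, by linarith, ?_, hδ, fun x hx hxδ => ?_⟩
  · simpa using (ENNReal.toReal_lt_toReal ENNReal.one_ne_top hr_top).2 hr
  · have hx' : r < ENNReal.ofReal (cdfOf ν (c * x) / cdfOf ν x) := hδr ⟨hx, hxδ⟩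
    exact (le_div_iff₀ (hpos x hx)).1 ((ENNReal.lt_ofReal_iff_toReal_lt hr_top).1 hx').le

/-- If `G` grows by the factor `r` under dilation by `c` near `0`, then `G⁻¹(r y) ≤ c G⁻¹(y)`
whenever `G⁻¹(y)` is small. -/
lemma cdfInv_mul_le {ν : MeasureTheory.Measure ℝ} [MeasureTheory.IsProbabilityMeasure ν]
    {c r δ y : ℝ} (hc : 0 < c) (hr : 0 ≤ r)
    (h : ∀ x, 0 < x → x < δ → r * cdfOf ν x ≤ cdfOf ν (c * x)) (hy : y < 1)
    (hyδ : cdfInv ν y < δ) : cdfInv ν (r * y) ≤ c * cdfInv ν y := by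
  rw [← div_le_iff₀' hc]
  refine le_of_forall_gt_imp_ge_of_dense fun a ha => ?_
  obtain ⟨x, hx, hxm⟩ := exists_between (lt_min ha hyδ)
  have hx0 : 0 < x := (cdfInv_nonneg ν y).trans_lt hx
  rw [div_le_iff₀' hc]
  calc cdfInv ν (r * y) ≤ c * x := cdfInv_le_of_le_cdfOf (by positivity)
        ((mul_le_mul_of_nonneg_left (le_cdfOf_of_cdfInv_lt hy hx) hr).trans
          (h x hx0 (hxm.trans_le (min_le_right _ _))))
    _ ≤ c * a := by gcongr; exact (hxm.trans_le (min_le_left _ _)).le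

/-- the deterministic step in the forward direction of Theorem 1.4.
If `G` is controlled near `0` and `f : ℕ → ℕ` is non-decreasing with
`∑_n G⁻¹(f(n)⁻¹) < ∞`, then there is `ε > 0` with `∑_n G⁻¹((1+ε)/f(n)) < ∞`. -/
theorem onePlusEps_summable_of_gSmall
    (ν : MeasureTheory.Measure ℝ) [MeasureTheory.IsProbabilityMeasure ν]
    (hν : ν (Set.Iio 0) = 0)
    (hctrl : ControlledNearZero ν)
    (f : ℕ → ℕ) (hf1 : ∀ n, 1 ≤ f n) (hfmono : Monotone f)
    (hsmall : Summable fun n : ℕ => cdfInv ν ((f n : ℝ)⁻¹)) :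
    ∃ ε : ℝ, 0 < ε ∧ Summable fun n : ℕ => cdfInv ν ((1 + ε) / (f n : ℝ)) := by
  obtain ⟨c, r, δ, hc, hr, hδ, h⟩ := hctrl.exists_mul_le
  refine ⟨r - 1, by linarith, ?_⟩
  simp only [add_sub_cancel, div_eq_mul_inv]
  by_cases hN : ∃ N, 2 ≤ f N
  · obtain ⟨N, hN⟩ := hN
    refine (hsmall.mul_left c).of_norm_bounded_eventually_nat ?_
    filter_upwards [eventually_ge_atTop N, hsmall.tendsto_atTop_zero.eventually_lt_const hδ]
      with n hn hnδ
    have hfn : (1 : ℝ) < f n := by exact_mod_cast hN.trans (hfmono hn)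
    rw [Real.norm_of_nonneg (cdfInv_nonneg _ _)]
    exact cdfInv_mul_le hc (by linarith) h (inv_lt_one_of_one_lt₀ hfn) hnδ
  · push Not at hN
    have hf : ∀ n, f n = 1 := fun n => by have := hf1 n; have := hN n; omega
    simp [hf, cdfInv_of_one_lt hr, summable_zero]

end
end
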